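/- Let A ∈ ℝ^{m×n} be a matrix each of whose rows has exactly two entries equal to 1 and all other entries equal to 0, and let a, b ∈ ℤⁿ be integral vectors. Then the polytope Q = {y ∈ ℝⁿ : A y ≤ 0 componentwise, a ≤ y ≤ b componentwise} is integral: every extreme point of Q has all integer coordinates. -/

import Mathlib

open Filter Topology in
/-- An affine constraint which, when tight at the base point, is constant along the perturbation
survives small perturbations. -/
theorem eventually_add_mul_le {p q c : ℝ} (hle : p ≤ c) (htight : p = c → q = 0) :
    ∀ᶠ ε in 𝓝 (0 : ℝ), p + ε * q ≤ c := by
  rcases hle.lt_or_eq with hlt | heq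
  · have hcont : Tendsto (fun ε : ℝ => p + ε * q) (𝓝 0) (𝓝 p) := by
      have h : Continuous fun ε : ℝ => p + ε * q := by fun_prop
      simpa using h.tendsto 0
    filter_upwards [hcont.eventually (gt_mem_nhds hlt)] with ε hε using hε.le
  · simp [htight heq, heq]

open Filter Topology in
/-- If all small perturbations of an extreme point along a direction stay in the set, then the
direction is zero. -/
theorem eq_zero_of_mem_extremePoints_of_eventually {E : Type*} [AddCommGroup E] [Module ℝ E]
    {Q : Set E} {y d : E} (hy : y ∈ Set.extremePoints ℝ Q)
    (hd : ∀ᶠ ε in 𝓝 (0 : ℝ), y + ε • d ∈ Q) : d = 0 := by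
  have hneg : ∀ᶠ ε in 𝓝 (0 : ℝ), y + (-ε) • d ∈ Q := by
    have h : Tendsto (fun ε : ℝ => -ε) (𝓝 0) (𝓝 0) := by
      simpa using (continuous_neg (G := ℝ)).tendsto 0
    exact h.eventually hd
  obtain ⟨ε, ⟨hplus, hminus⟩, hε⟩ :=
    (((hd.and hneg).filter_mono nhdsWithin_le_nhds).and
      (self_mem_nhdsWithin : Set.Ioi (0 : ℝ) ∈ 𝓝[>] 0)).exists
  have hseg : y ∈ openSegment ℝ (y + ε • d) (y + (-ε) • d) :=
    ⟨1 / 2, 1 / 2, by norm_num, by norm_num, by norm_num, by module⟩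
  have heq : y + ε • d = y := hy.2 hplus hminus hseg
  simpa [hε.ne'] using heq

/-- The product of a vector with a row having exactly two entries `1`, all others being `0`. -/
theorem Matrix.mulVec_eq_add_of_two_ones {m n R : Type*} [Fintype n] [NonAssocSemiring R]
    {A : Matrix m n R} {i : m} {j₁ j₂ : n} (hne : j₁ ≠ j₂) (h₁ : A i j₁ = 1) (h₂ : A i j₂ = 1)
    (h₀ : ∀ j, j ≠ j₁ → j ≠ j₂ → A i j = 0) (v : n → R) :
    A.mulVec v i = v j₁ + v j₂ := by
  rw [Matrix.mulVec, dotProduct, Fintype.sum_eq_add j₁ j₂ hne]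
  · simp [h₁, h₂]
  · rintro j ⟨hj₁, hj₂⟩
    simp [h₀ j hj₁ hj₂]

open Classical in
/-- The sign of a real number, except that every integer is sent to `0`. -/
noncomputable def nonintegralSign (x : ℝ) : ℝ :=
  if ∃ z : ℤ, x = z then 0 else if 0 < x then 1 else -1

theorem nonintegralSign_eq_zero_iff {x : ℝ} : nonintegralSign x = 0 ↔ ∃ z : ℤ, x = z := by
  unfold nonintegralSign
  split_ifs with h <;> simp [h]

theorem nonintegralSign_neg (x : ℝ) : nonintegralSign (-x) = -nonintegralSign x := by
  have hiff : (∃ z : ℤ, -x = z) ↔ ∃ z : ℤ, x = z :=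
    ⟨fun ⟨z, hz⟩ => ⟨-z, by push_cast; linarith⟩, fun ⟨z, hz⟩ => ⟨-z, by push_cast; linarith⟩⟩
  by_cases h : ∃ z : ℤ, x = z
  · rw [nonintegralSign_eq_zero_iff.2 h, nonintegralSign_eq_zero_iff.2 (hiff.2 h), neg_zero]
  · have hx : x ≠ 0 := fun hx => h ⟨0, by simpa using hx⟩
    rcases hx.lt_or_gt with hx | hx <;>
      simp [nonintegralSign, h, mt hiff.1 h, hx, not_lt_of_gt hx]

/-- Lemma B1: if each row of `A` has exactly two entries equal to 1 and all other
entries 0, and `a, b` are integral, then `{y : A y ≤ 0, a ≤ y ≤ b}` is an integral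
polytope. -/
theorem stmt7 (m n : ℕ) (A : Matrix (Fin m) (Fin n) ℝ)
    (hA : ∀ i : Fin m, ∃ j₁ j₂ : Fin n, j₁ ≠ j₂ ∧ A i j₁ = 1 ∧ A i j₂ = 1 ∧
      ∀ j, j ≠ j₁ → j ≠ j₂ → A i j = 0)
    (a b : Fin n → ℤ)
    (Q : Set (Fin n → ℝ))
    (hQ : Q = {y | (∀ i, A.mulVec y i ≤ 0) ∧ ∀ j, (a j : ℝ) ≤ y j ∧ y j ≤ (b j : ℝ)}) :
    ∀ y ∈ Set.extremePoints ℝ Q, ∀ j, ∃ z : ℤ, y j = (z : ℝ) := by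
  intro y hy j
  obtain ⟨hrow, hbox⟩ : (∀ i, A.mulVec y i ≤ 0) ∧ ∀ j, (a j : ℝ) ≤ y j ∧ y j ≤ (b j : ℝ) := by
    simpa [hQ] using hy.1
  set d : Fin n → ℝ := fun j => nonintegralSign (y j) with hd
  suffices hzero : d = 0 from nonintegralSign_eq_zero_iff.1 (congrFun hzero j)
  refine eq_zero_of_mem_extremePoints_of_eventually hy ?_
  simp only [hQ, Set.mem_ofPred_eq, Filter.eventually_and, Filter.eventually_all]
  refine ⟨fun i => ?_, fun k => ⟨?_, ?_⟩⟩
  · obtain ⟨j₁, j₂, hne, h₁, h₂, h₀⟩ := hA i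
    have hmul := Matrix.mulVec_eq_add_of_two_ones hne h₁ h₂ h₀
    have hle := hrow i
    simp only [Matrix.mulVec_add, Matrix.mulVec_smul, Pi.add_apply, Pi.smul_apply, smul_eq_mul]
    refine eventually_add_mul_le hle fun htight => ?_
    rw [hmul] at htight ⊢
    simp [hd, eq_neg_of_add_eq_zero_left htight, nonintegralSign_neg]
  · have h := eventually_add_mul_le (q := -d k) (neg_le_neg (hbox k).1) fun htight =>
      neg_eq_zero.2 (nonintegralSign_eq_zero_iff.2 ⟨a k, neg_injective htight⟩)
    filter_upwards [h] with ε hε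
    simp only [Pi.add_apply, Pi.smul_apply, smul_eq_mul]
    linarith
  · exact eventually_add_mul_le (hbox k).2 fun htight =>
      nonintegralSign_eq_zero_iff.2 ⟨b k, htight⟩
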